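/- arXiv:cs/0507018 — 2 statements merged into one kernel-verified Lean document; each statement's English description precedes it below -/
import Mathlib

section
/- Let r : ℤ → ℝ satisfy r(−k) = r(k) and Σ_k |r(k)| < ∞, with spectral density S(ω) = Σ_{k∈ℤ} r(k)e^{−ikω} satisfying 0 ≤ S(ω) ≤ M for all ω, and suppose each Toeplitz matrix Σ_n = (r(i−j))_{1≤i,j≤n} is positive semidefinite. Let m ≥ 0 and b₀, b₁, …, b_m be real numbers, let Q̃_n be the n×n symmetric banded Toeplitz matrix with (i,j)-entry b_{|i−j|} for |i−j| ≤ m and 0 otherwise, and let g_m(ω) = b₀ + 2Σ_{l=1}^m b_l cos(lω). Let μ₁⁽ⁿ⁾,…,μₙ⁽ⁿ⁾ be the (real) eigenvalues of the matrix Q̃_n Σ_n. Then for every continuous function h : ℝ → ℝ, lim_{n→∞} (1/n) Σ_{i=1}^n h(μ_i⁽ⁿ⁾) = (1/2π) ∫₀^{2π} h(g_m(ω)·S(ω)) dω. -/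
open Matrix Filter Topology

/-- The `n × n` Toeplitz matrix with entries `a (i - j)`. -/
def toeplitzMatrix (a : ℤ → ℝ) (n : ℕ) : Matrix (Fin n) (Fin n) ℝ :=
  Matrix.of fun i j => a ((i.val : ℤ) - (j.val : ℤ))

/-- The symbol `ω ↦ ∑ₖ a k e^{-ikω}` of a sequence. -/
noncomputable def toeplitzSymbol (a : ℤ → ℝ) (ω : ℝ) : ℂ :=
  ∑' k : ℤ, (a k : ℂ) * Complex.exp (-Complex.I * k * ω)

/-- Convolution of sequences indexed by `ℤ`. -/
noncomputable def intConv (a b : ℤ → ℝ) (k : ℤ) : ℝ := ∑' l : ℤ, a l * b (k - l)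

/-- The sum of the absolute values of the entries of a matrix. -/
def entryAbsSum {n : ℕ} (A : Matrix (Fin n) (Fin n) ℝ) : ℝ := ∑ i, ∑ j, |A i j|

/-- The shear `(l, k) ↦ (l, k - l)` of `ℤ × ℤ`. -/
def intShear : ℤ × ℤ ≃ ℤ × ℤ where
  toFun p := (p.1, p.2 - p.1)
  invFun p := (p.1, p.2 + p.1)
  left_inv p := by simp
  right_inv p := by simp

lemma norm_exp_neg_I_int_mul (k : ℤ) (ω : ℝ) :
    ‖Complex.exp (-Complex.I * k * ω)‖ = 1 := by
  rw [show -Complex.I * k * ω = ((-(k * ω) : ℝ) : ℂ) * Complex.I by push_cast; ring]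
  exact Complex.norm_exp_ofReal_mul_I _

lemma norm_symbol_term (a : ℤ → ℝ) (k : ℤ) (ω : ℝ) :
    ‖(a k : ℂ) * Complex.exp (-Complex.I * k * ω)‖ = |a k| := by
  rw [norm_mul, norm_exp_neg_I_int_mul, mul_one, Complex.norm_real, Real.norm_eq_abs]

lemma norm_toeplitzSymbol_le {a : ℤ → ℝ} (ha : Summable fun k => |a k|) (ω : ℝ) :
    ‖toeplitzSymbol a ω‖ ≤ ∑' k, |a k| := by
  simp_rw [← norm_symbol_term a _ ω] at ha ⊢
  exact norm_tsum_le_tsum_norm ha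

lemma continuous_toeplitzSymbol {a : ℤ → ℝ} (ha : Summable fun k => |a k|) :
    Continuous (toeplitzSymbol a) :=
  continuous_tsum (fun k => by fun_prop) ha fun k ω => (norm_symbol_term a k ω).le

lemma summable_shear_mul {a b : ℤ → ℝ} (ha : Summable fun k => |a k|)
    (hb : Summable fun k => |b k|) :
    Summable fun p : ℤ × ℤ => |a p.1 * b (p.2 - p.1)| := by
  have h := summable_mul_of_summable_norm (f := fun k => |a k|) (g := fun k => |b k|)
    (by simpa using ha) (by simpa using hb)
  refine ((intShear.summable_iff).mpr h).congr fun p => ?_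
  simp [intShear, abs_mul]

lemma summable_intConv {a b : ℤ → ℝ} (ha : Summable fun k => |a k|)
    (hb : Summable fun k => |b k|) : Summable fun k => |intConv a b k| := by
  have h : Summable fun p : ℤ × ℤ => |a p.2 * b (p.1 - p.2)| :=
    (summable_shear_mul ha hb).prod_symm
  refine Summable.of_nonneg_of_le (fun k => abs_nonneg _) (fun k => ?_) h.prod
  exact norm_tsum_le_tsum_norm (f := fun l => a l * b (k - l)) (h.prod_factor k)

lemma toeplitzSymbol_intConv {a b : ℤ → ℝ} (ha : Summable fun k => |a k|)
    (hb : Summable fun k => |b k|) (ω : ℝ) :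
    toeplitzSymbol (intConv a b) ω = toeplitzSymbol a ω * toeplitzSymbol b ω := by
  have ha' := ha
  have hb' := hb
  simp_rw [← norm_symbol_term _ _ ω] at ha' hb'
  have key (p : ℤ × ℤ) : ((a p.1 * b (p.2 - p.1) : ℝ) : ℂ) *
      Complex.exp (-Complex.I * p.2 * ω) =
      (a p.1 * Complex.exp (-Complex.I * p.1 * ω)) *
        (b (p.2 - p.1) * Complex.exp (-Complex.I * (p.2 - p.1 : ℤ) * ω)) := by
    have : Complex.exp (-Complex.I * p.2 * ω) = Complex.exp (-Complex.I * p.1 * ω) *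
        Complex.exp (-Complex.I * (p.2 - p.1 : ℤ) * ω) := by
      rw [← Complex.exp_add]; congr 1; push_cast; ring
    rw [this]; push_cast; ring
  have hs : Summable fun p : ℤ × ℤ => ((a p.1 * b (p.2 - p.1) : ℝ) : ℂ) *
      Complex.exp (-Complex.I * p.2 * ω) := by
    refine Summable.of_norm ((summable_shear_mul ha hb).congr fun p => ?_)
    rw [norm_mul, norm_exp_neg_I_int_mul, mul_one, Complex.norm_real, Real.norm_eq_abs]
  rw [toeplitzSymbol, toeplitzSymbol, toeplitzSymbol,
    tsum_mul_tsum_of_summable_norm ha' hb', ← intShear.tsum_eq]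
  calc _ = ∑' k : ℤ, ∑' l : ℤ, ((a l * b (k - l) : ℝ) : ℂ) *
        Complex.exp (-Complex.I * k * ω) := by
        refine tsum_congr fun k => ?_
        rw [intConv, tsum_mul_right, Complex.ofReal_tsum]
    _ = ∑' p : ℤ × ℤ, ((a p.1 * b (p.2 - p.1) : ℝ) : ℂ) *
        Complex.exp (-Complex.I * p.2 * ω) := by
        rw [← (Equiv.prodComm ℤ ℤ).tsum_eq]
        exact (hs.prod_symm.tsum_prod).symm
    _ = _ := tsum_congr fun p => key p

lemma intervalIntegral_exp_neg_I_int_mul (k : ℤ) :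
    ∫ ω in (0 : ℝ)..(2 * Real.pi), Complex.exp (-Complex.I * k * ω) =
      if k = 0 then 2 * Real.pi else 0 := by
  split_ifs with hk
  · simp [hk]
  · rw [integral_exp_mul_complex (by simp [hk])]
    have : -Complex.I * k * ((2 * Real.pi : ℝ) : ℂ) = (-k : ℤ) * (2 * Real.pi * Complex.I) := by
      push_cast; ring
    rw [this, Complex.exp_int_mul_two_pi_mul_I]
    simp

lemma intervalIntegral_toeplitzSymbol {a : ℤ → ℝ} (ha : Summable fun k => |a k|) :
    ∫ ω in (0 : ℝ)..(2 * Real.pi), toeplitzSymbol a ω = 2 * Real.pi * a 0 := by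
  have h : HasSum (fun k : ℤ => ∫ ω in (0 : ℝ)..(2 * Real.pi),
      (a k : ℂ) * Complex.exp (-Complex.I * k * ω))
      (∫ ω in (0 : ℝ)..(2 * Real.pi), toeplitzSymbol a ω) := by
    apply intervalIntegral.hasSum_integral_of_dominated_convergence (fun k _ => |a k|)
    · intro k
      exact Continuous.aestronglyMeasurable (by fun_prop)
    · exact fun k => .of_forall fun ω _ => (norm_symbol_term a k ω).le
    · exact .of_forall fun _ _ => ha
    · exact intervalIntegrable_const
    · refine .of_forall fun ω _ => Summable.hasSum (Summable.of_norm ?_)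
      exact ha.congr fun k => (norm_symbol_term a k ω).symm
  rw [← h.tsum_eq, tsum_eq_single 0]
  · rw [intervalIntegral.integral_const_mul, intervalIntegral_exp_neg_I_int_mul]
    simp [mul_comm]
  · intro k hk
    rw [intervalIntegral.integral_const_mul, intervalIntegral_exp_neg_I_int_mul]
    simp [hk]

lemma sum_comp_injective_le_tsum {f : ℤ → ℝ} (hf : Summable f) (h0 : ∀ k, 0 ≤ f k) {n : ℕ}
    {e : Fin n → ℤ} (he : Function.Injective e) : ∑ j, f (e j) ≤ ∑' k, f k := by
  rw [← Finset.sum_image (f := f) (g := e) (s := Finset.univ) he.injOn]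
  exact hf.sum_le_tsum _ fun k _ => h0 k

lemma toeplitzMatrix_row_sum_le {a : ℤ → ℝ} (ha : Summable fun k => |a k|) {n : ℕ} (i : Fin n) :
    ∑ j, |toeplitzMatrix a n i j| ≤ ∑' k, |a k| :=
  sum_comp_injective_le_tsum ha (fun _ => abs_nonneg _)
    (e := fun j : Fin n => (i.val : ℤ) - (j.val : ℤ)) fun j k h => by
      simp only at h; omega

lemma entryAbsSum_add_le {n : ℕ} (A B : Matrix (Fin n) (Fin n) ℝ) :
    entryAbsSum (A + B) ≤ entryAbsSum A + entryAbsSum B := by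
  simp only [entryAbsSum, ← Finset.sum_add_distrib]
  exact Finset.sum_le_sum fun i _ => Finset.sum_le_sum fun j _ => abs_add_le _ _

lemma sum_abs_mul_row_le {n : ℕ} (A B : Matrix (Fin n) (Fin n) ℝ) {R : ℝ}
    (hB : ∀ i, ∑ j, |B i j| ≤ R) (i : Fin n) :
    ∑ j, |(A * B) i j| ≤ (∑ l, |A i l|) * R := by
  calc _ ≤ ∑ j, ∑ l, |A i l| * |B l j| := by
        refine Finset.sum_le_sum fun j _ => ?_
        simp_rw [Matrix.mul_apply, ← abs_mul]
        exact Finset.abs_sum_le_sum_abs _ _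
    _ = ∑ l, |A i l| * ∑ j, |B l j| := by
        rw [Finset.sum_comm]; simp_rw [Finset.mul_sum]
    _ ≤ _ := by
        rw [Finset.sum_mul]
        exact Finset.sum_le_sum fun l _ => mul_le_mul_of_nonneg_left (hB l) (abs_nonneg _)

lemma entryAbsSum_mul_le {n : ℕ} (A B : Matrix (Fin n) (Fin n) ℝ) {R : ℝ}
    (hB : ∀ i, ∑ j, |B i j| ≤ R) : entryAbsSum (A * B) ≤ entryAbsSum A * R := by
  rw [entryAbsSum, entryAbsSum, Finset.sum_mul]
  exact Finset.sum_le_sum fun i _ => sum_abs_mul_row_le A B hB i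

lemma abs_trace_le_entryAbsSum {n : ℕ} (A : Matrix (Fin n) (Fin n) ℝ) :
    |A.trace| ≤ entryAbsSum A :=
  (Finset.abs_sum_le_sum_abs _ _).trans <| Finset.sum_le_sum fun i _ =>
    Finset.single_le_sum (f := fun j => |A i j|) (fun _ _ => abs_nonneg _) (Finset.mem_univ i)

/-- The number of rows of an `n × n` matrix that the `k`-th diagonal does not meet. -/
def diagonalDefect (n : ℕ) (k : ℤ) : ℕ :=
  (Finset.univ.filter fun i : Fin n => (i.val : ℤ) - k < 0 ∨ (n : ℤ) ≤ i.val - k).card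

lemma diagonalDefect_le (n : ℕ) (k : ℤ) : diagonalDefect n k ≤ n :=
  (Finset.card_filter_le _ _).trans (by simp)

lemma diagonalDefect_le_natAbs (n : ℕ) (k : ℤ) : diagonalDefect n k ≤ k.natAbs := by
  rcases le_total 0 k with hk | hk
  · refine (Finset.card_le_card_of_injOn (t := Finset.range k.natAbs) (fun i => i.val)
      ?_ fun i _ j _ h => Fin.ext h).trans (by simp)
    intro i hi
    have := i.isLt
    simp at hi ⊢
    omega
  · refine (Finset.card_le_card_of_injOn (t := Finset.range k.natAbs) (fun i => n - 1 - i.val)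
      ?_ fun i _ j _ h => Fin.ext (by simp only at h; omega)).trans (by simp)
    intro i hi
    have := i.isLt
    simp at hi ⊢
    omega

lemma tendsto_tsum_diagonalDefect {c : ℤ → ℝ} (hc : Summable fun k => |c k|) :
    Tendsto (fun n : ℕ => ∑' k, |c k| * (diagonalDefect n k / n)) atTop (𝓝 0) := by
  have h : Tendsto (fun n : ℕ => ∑' k, |c k| * (diagonalDefect n k / n)) atTop
      (𝓝 (∑' _ : ℤ, (0 : ℝ))) := by
    refine tendsto_tsum_of_dominated_convergence hc (fun k => ?_) (.of_forall fun n k => ?_)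
    · rw [← mul_zero |c k|]
      refine Tendsto.const_mul _ ?_
      refine squeeze_zero (fun n => by positivity) (fun n => ?_)
        (tendsto_const_div_atTop_nhds_zero_nat (k.natAbs : ℝ))
      gcongr
      exact diagonalDefect_le_natAbs n k
    · rw [Real.norm_eq_abs, abs_of_nonneg (by positivity)]
      refine mul_le_of_le_one_right (abs_nonneg _) (div_le_one_of_le₀ ?_ (by positivity))
      exact_mod_cast diagonalDefect_le n k
  simpa using h

lemma abs_toeplitz_mul_sub_le {c a : ℤ → ℝ} (hc : Summable fun k => |c k|)
    (ha : Summable fun k => |a k|) {n : ℕ} (i j : Fin n) :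
    |(toeplitzMatrix c n * toeplitzMatrix a n - toeplitzMatrix (intConv c a) n) i j| ≤
      ∑' k : ℤ, if (i.val : ℤ) - k < 0 ∨ (n : ℤ) ≤ i.val - k then
        |c k| * |a ((i.val : ℤ) - k - j.val)| else 0 := by
  set x : ℤ := (i.val : ℤ)
  set y : ℤ := (j.val : ℤ)
  have hsum : Summable fun k => |c k * a (x - y - k)| :=
    (summable_shear_mul hc ha).prod_symm.prod_factor (x - y)
  let s : Finset ℤ := Finset.univ.image fun l : Fin n => x - (l.val : ℤ)
  have hmem (k : ℤ) : k ∉ s ↔ (x - k < 0 ∨ (n : ℤ) ≤ x - k) := by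
    simp only [s, Finset.mem_image, Finset.mem_univ, true_and, not_exists]
    constructor
    · intro h
      by_contra! h'
      exact h ⟨(x - k).toNat, by omega⟩ (by simp only; omega)
    · intro h l
      have := l.isLt
      omega
  have h1 : (toeplitzMatrix c n * toeplitzMatrix a n) i j = ∑ k ∈ s, c k * a (x - y - k) := by
    rw [Finset.sum_image, Matrix.mul_apply]
    · refine Finset.sum_congr rfl fun l _ => ?_
      simp only [toeplitzMatrix, Matrix.of_apply]
      congr 2
      ring
    · intro l _ l' _ h
      simp only at h
      omega
  have h2 : toeplitzMatrix (intConv c a) n i j = ∑ k ∈ s, c k * a (x - y - k) +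
      ∑' k : ℤ, (↑s : Set ℤ)ᶜ.indicator (fun k => c k * a (x - y - k)) k := by
    rw [← tsum_subtype]
    exact (hsum.of_abs.sum_add_tsum_compl).symm
  rw [Matrix.sub_apply, h1, h2, sub_add_cancel_left, abs_neg]
  have h3 (k : ℤ) : ‖(↑s : Set ℤ)ᶜ.indicator (fun k => c k * a (x - y - k)) k‖ =
      if x - k < 0 ∨ (n : ℤ) ≤ x - k then |c k| * |a (x - k - y)| else 0 := by
    simp only [Set.indicator_apply, Set.mem_compl_iff, Finset.mem_coe, hmem]
    split_ifs
    · rw [Real.norm_eq_abs, abs_mul, sub_right_comm]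
    · simp
  simp_rw [← h3]
  rw [← Real.norm_eq_abs]
  refine norm_tsum_le_tsum_norm ?_
  simp_rw [norm_indicator_eq_indicator_norm]
  exact hsum.indicator _

lemma entryAbsSum_toeplitz_mul_sub_le {c a : ℤ → ℝ} (hc : Summable fun k => |c k|)
    (ha : Summable fun k => |a k|) (n : ℕ) :
    entryAbsSum (toeplitzMatrix c n * toeplitzMatrix a n - toeplitzMatrix (intConv c a) n) ≤
      (∑' k, |c k| * diagonalDefect n k) * ∑' k, |a k| := by
  have hs (i j : Fin n) : Summable fun k : ℤ => if (i.val : ℤ) - k < 0 ∨ (n : ℤ) ≤ i.val - k then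
        |c k| * |a ((i.val : ℤ) - k - j.val)| else 0 := by
    have hsum : Summable fun k => |c k * a ((i.val : ℤ) - j.val - k)| :=
      (summable_shear_mul hc ha).prod_symm.prod_factor ((i.val : ℤ) - j.val)
    refine Summable.of_nonneg_of_le (fun k => ?_) (fun k => ?_) hsum
    · split_ifs <;> positivity
    · split_ifs
      · rw [abs_mul, sub_right_comm]
      · positivity
  have hd : Summable fun k => |c k| * (diagonalDefect n k : ℝ) := by
    refine Summable.of_nonneg_of_le (fun k => by positivity) (fun k => ?_) (hc.mul_right (n : ℝ))
    gcongr
    exact diagonalDefect_le n k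
  calc _ ≤ ∑ i : Fin n, ∑ j : Fin n, ∑' k : ℤ,
        if (i.val : ℤ) - k < 0 ∨ (n : ℤ) ≤ i.val - k then
          |c k| * |a ((i.val : ℤ) - k - j.val)| else 0 :=
        Finset.sum_le_sum fun i _ => Finset.sum_le_sum fun j _ => abs_toeplitz_mul_sub_le hc ha i j
    _ = ∑' k : ℤ, ∑ i : Fin n, ∑ j : Fin n,
        if (i.val : ℤ) - k < 0 ∨ (n : ℤ) ≤ i.val - k then
          |c k| * |a ((i.val : ℤ) - k - j.val)| else 0 := by
        rw [Summable.tsum_finsetSum fun i _ => summable_sum fun j _ => hs i j]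
        refine Finset.sum_congr rfl fun i _ => ?_
        rw [Summable.tsum_finsetSum fun j _ => hs i j]
    _ ≤ ∑' k, |c k| * diagonalDefect n k * ∑' l, |a l| := by
        refine Summable.tsum_le_tsum (fun k => ?_)
          (summable_sum fun i _ => summable_sum fun j _ => hs i j) (hd.mul_right _)
        rw [diagonalDefect, Finset.card_filter]
        push_cast
        rw [Finset.mul_sum, Finset.sum_mul]
        refine Finset.sum_le_sum fun i _ => ?_
        split_ifs
        · rw [mul_one, ← Finset.mul_sum]
          gcongr
          exact sum_comp_injective_le_tsum ha (fun _ => abs_nonneg _)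
            (e := fun j : Fin n => (i.val : ℤ) - k - (j.val : ℤ)) fun j j' h => by
              simp only at h; omega
        · simp
    _ = _ := tsum_mul_right

/-- A sequence of matrices is asymptotic, in normalized entrywise `ℓ¹` sense, to the Toeplitz
matrices of an absolutely summable sequence with symbol `f`. -/
def HasToeplitzSymbol (A : (n : ℕ) → Matrix (Fin n) (Fin n) ℝ) (f : ℝ → ℂ) : Prop :=
  ∃ c : ℤ → ℝ, (Summable fun k => |c k|) ∧ toeplitzSymbol c = f ∧
    Tendsto (fun n : ℕ => entryAbsSum (A n - toeplitzMatrix c n) / n) atTop (𝓝 0)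

lemma entryAbsSum_nonneg {n : ℕ} (A : Matrix (Fin n) (Fin n) ℝ) : 0 ≤ entryAbsSum A :=
  Finset.sum_nonneg fun _ _ => Finset.sum_nonneg fun _ _ => abs_nonneg _

lemma HasToeplitzSymbol.one : HasToeplitzSymbol (fun _ => 1) 1 := by
  refine ⟨Pi.single 0 1, ?_, ?_, ?_⟩
  · refine summable_of_hasFiniteSupport ((Set.finite_singleton 0).subset fun k hk => ?_)
    by_contra h
    simp_all
  · ext ω
    rw [toeplitzSymbol, tsum_eq_single 0]
    · simp
    · intro k hk
      simp [hk]
  · have (n : ℕ) : toeplitzMatrix (Pi.single 0 1) n = 1 := by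
      ext i j
      simp [toeplitzMatrix, Matrix.one_apply, Pi.single_apply, sub_eq_zero, Fin.ext_iff]
    simp [this, entryAbsSum]

lemma HasToeplitzSymbol.mul_toeplitzMatrix {A : (n : ℕ) → Matrix (Fin n) (Fin n) ℝ} {f : ℝ → ℂ}
    (hA : HasToeplitzSymbol A f) {a : ℤ → ℝ} (ha : Summable fun k => |a k|) :
    HasToeplitzSymbol (fun n => A n * toeplitzMatrix a n) (f * toeplitzSymbol a) := by
  obtain ⟨c, hc, rfl, hlim⟩ := hA
  refine ⟨intConv c a, summable_intConv hc ha, funext (toeplitzSymbol_intConv hc ha), ?_⟩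
  have h := (hlim.mul_const (∑' k, |a k|)).add
    ((tendsto_tsum_diagonalDefect hc).mul_const (∑' k, |a k|))
  simp only [zero_mul, add_zero] at h
  refine squeeze_zero (fun n => div_nonneg (entryAbsSum_nonneg _) (by positivity))
    (fun n => ?_) h
  have h1 : A n * toeplitzMatrix a n - toeplitzMatrix (intConv c a) n =
      (A n - toeplitzMatrix c n) * toeplitzMatrix a n +
      (toeplitzMatrix c n * toeplitzMatrix a n - toeplitzMatrix (intConv c a) n) := by
    rw [Matrix.sub_mul]; abel
  have h2 := (entryAbsSum_add_le _ _).trans (add_le_add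
    (entryAbsSum_mul_le (A n - toeplitzMatrix c n) _ (toeplitzMatrix_row_sum_le ha))
    (entryAbsSum_toeplitz_mul_sub_le hc ha n))
  rw [h1]
  refine (div_le_div_of_nonneg_right h2 (Nat.cast_nonneg n)).trans_eq ?_
  simp_rw [← mul_div_assoc, tsum_div_const]
  ring

lemma HasToeplitzSymbol.pow_mul {a b : ℤ → ℝ} (ha : Summable fun k => |a k|)
    (hb : Summable fun k => |b k|) (p : ℕ) :
    HasToeplitzSymbol (fun n => (toeplitzMatrix a n * toeplitzMatrix b n) ^ p)
      ((toeplitzSymbol a * toeplitzSymbol b) ^ p) := by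
  induction p with
  | zero => simpa using HasToeplitzSymbol.one
  | succ p ih =>
    simpa only [pow_succ, mul_assoc] using
      (ih.mul_toeplitzMatrix ha).mul_toeplitzMatrix hb

lemma HasToeplitzSymbol.tendsto_trace {A : (n : ℕ) → Matrix (Fin n) (Fin n) ℝ} {F : ℝ → ℝ}
    (hA : HasToeplitzSymbol A fun ω => (F ω : ℂ)) :
    Tendsto (fun n : ℕ => (1 / (n : ℝ)) * (A n).trace) atTop
      (𝓝 ((1 / (2 * Real.pi)) * ∫ ω in (0 : ℝ)..(2 * Real.pi), F ω)) := by
  obtain ⟨c, hc, hF, hlim⟩ := hA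
  have hint : ∫ ω in (0 : ℝ)..(2 * Real.pi), F ω = 2 * Real.pi * c 0 := by
    have := intervalIntegral_toeplitzSymbol hc
    rw [hF, intervalIntegral.integral_ofReal] at this
    exact_mod_cast this
  have hpi : 1 / (2 * Real.pi) * (2 * Real.pi * c 0) = c 0 := by field_simp
  rw [hint, hpi, tendsto_iff_norm_sub_tendsto_zero]
  refine squeeze_zero' (.of_forall fun n => norm_nonneg _) ?_ hlim
  filter_upwards [eventually_gt_atTop 0] with n hn
  have hn' : (0 : ℝ) < n := by exact_mod_cast hn
  have htr : (toeplitzMatrix c n).trace = n * c 0 := by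
    simp [Matrix.trace, toeplitzMatrix]
  rw [le_div_iff₀ hn', Real.norm_eq_abs, ← abs_of_pos hn', ← abs_mul, abs_of_pos hn']
  refine Eq.trans_le ?_ (abs_trace_le_entryAbsSum (A n - toeplitzMatrix c n))
  rw [Matrix.trace_sub, htr]
  congr 1
  field_simp

lemma exists_isHermitian_mul_self_eq {n : ℕ} {P : Matrix (Fin n) (Fin n) ℝ}
    (hP : P.PosSemidef) : ∃ B : Matrix (Fin n) (Fin n) ℝ, B.IsHermitian ∧ B * B = P := by
  open scoped MatrixOrder in
  exact ⟨CFC.sqrt P, (CFC.sqrt_nonneg P).posSemidef.isHermitian,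
    CFC.sqrt_mul_sqrt_self P hP.nonneg⟩

lemma trace_mul_pow_comm {n : ℕ} (A B : Matrix (Fin n) (Fin n) ℝ) (p : ℕ) :
    ((A * B) ^ p).trace = ((B * A) ^ p).trace := by
  cases p with
  | zero => simp
  | succ p => rw [pow_succ, ← mul_assoc, mul_pow_mul, Matrix.trace_mul_comm, pow_succ', mul_assoc]

lemma trace_pow_eq_sum_eigenvalues_pow {n : ℕ} {H : Matrix (Fin n) (Fin n) ℝ}
    (hH : H.IsHermitian) (p : ℕ) : (H ^ p).trace = ∑ i, hH.eigenvalues i ^ p := by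
  conv_lhs => rw [hH.spectral_theorem, ← map_pow, Unitary.conjStarAlgAut_apply,
    Matrix.trace_mul_cycle, Unitary.coe_star_mul_self, one_mul, Matrix.diagonal_pow,
    Matrix.trace_diagonal]
  simp

lemma roots_prod_X_sub_C_fintype {n : ℕ} (μ : Fin n → ℝ) :
    (∏ i, (Polynomial.X - Polynomial.C (μ i))).roots = Finset.univ.val.map μ := by
  rw [Polynomial.roots_prod _ _ (by simp [Finset.prod_ne_zero_iff, Polynomial.X_sub_C_ne_zero])]
  simp

/-- The power sums of the roots of the characteristic polynomial of a product of a symmetric and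
a positive semidefinite matrix are the traces of the powers of the product. -/
lemma sum_pow_eq_trace_pow_mul {n : ℕ} {Q P : Matrix (Fin n) (Fin n) ℝ} (hQ : Q.IsHermitian)
    (hP : P.PosSemidef) {μ : Fin n → ℝ}
    (hμ : (Q * P).charpoly = ∏ i, (Polynomial.X - Polynomial.C (μ i))) (p : ℕ) :
    ∑ i, μ i ^ p = ((Q * P) ^ p).trace := by
  obtain ⟨B, hB, rfl⟩ := exists_isHermitian_mul_self_eq hP
  have hH : (B * (Q * B)).IsHermitian := by
    simp only [Matrix.IsHermitian, Matrix.conjTranspose_mul, hB.eq, hQ.eq, mul_assoc]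
  rw [← mul_assoc, Matrix.charpoly_mul_comm, hH.charpoly_eq] at hμ
  have hroots := congrArg Polynomial.roots hμ
  rw [roots_prod_X_sub_C_fintype, roots_prod_X_sub_C_fintype] at hroots
  rw [← mul_assoc, trace_mul_pow_comm, trace_pow_eq_sum_eigenvalues_pow hH]
  have hsum := congrArg (fun s : Multiset ℝ => (s.map (· ^ p)).sum) hroots
  simp only [Multiset.map_map] at hsum
  exact hsum.symm

lemma abs_le_of_charpoly_eq_prod {n : ℕ} {A : Matrix (Fin n) (Fin n) ℝ} {R : ℝ}
    (hA : ∀ i, ∑ j, |A i j| ≤ R) {μ : Fin n → ℝ}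
    (hμ : A.charpoly = ∏ i, (Polynomial.X - Polynomial.C (μ i))) (i : Fin n) : |μ i| ≤ R := by
  have hroot : A.charpoly.IsRoot (μ i) := by
    rw [hμ, Polynomial.IsRoot, Polynomial.eval_prod]
    exact Finset.prod_eq_zero (Finset.mem_univ i) (by simp)
  have hev : Module.End.HasEigenvalue (Matrix.toLin' A) (μ i) := by
    rw [Module.End.hasEigenvalue_iff_isRoot_charpoly, Matrix.charpoly_toLin']
    exact hroot
  obtain ⟨k, hk⟩ := eigenvalue_mem_ball hev
  refine le_trans ?_ (hA k)
  rw [Metric.mem_closedBall, Real.dist_eq] at hk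
  rw [← Finset.add_sum_erase _ _ (Finset.mem_univ k)]
  have := abs_sub_abs_le_abs_sub (μ i) (A k k)
  simp only [Real.norm_eq_abs] at hk
  linarith

lemma tendsto_average_of_polynomial {μ : (n : ℕ) → Fin n → ℝ} {R : ℝ}
    (hμ : ∀ n i, |μ n i| ≤ R) {F : ℝ → ℝ} (hF : Continuous F) (hFR : ∀ ω, |F ω| ≤ R)
    (hpow : ∀ p : ℕ, Tendsto (fun n : ℕ => (1 / (n : ℝ)) * ∑ i, μ n i ^ p) atTop
      (𝓝 ((1 / (2 * Real.pi)) * ∫ ω in (0 : ℝ)..(2 * Real.pi), F ω ^ p)))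
    {h : ℝ → ℝ} (hh : Continuous h) :
    Tendsto (fun n : ℕ => (1 / (n : ℝ)) * ∑ i, h (μ n i)) atTop
      (𝓝 ((1 / (2 * Real.pi)) * ∫ ω in (0 : ℝ)..(2 * Real.pi), h (F ω))) := by
  have hpoly (q : Polynomial ℝ) : Tendsto (fun n : ℕ => (1 / (n : ℝ)) * ∑ i, q.eval (μ n i)) atTop
      (𝓝 ((1 / (2 * Real.pi)) * ∫ ω in (0 : ℝ)..(2 * Real.pi), q.eval (F ω))) := by
    simp_rw [Polynomial.eval_eq_sum_range]
    rw [intervalIntegral.integral_finsetSum fun p _ =>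
      Continuous.intervalIntegrable (by fun_prop) _ _, Finset.mul_sum]
    simp_rw [intervalIntegral.integral_const_mul]
    have := tendsto_finsetSum (Finset.range (q.natDegree + 1)) fun p _ =>
      (hpow p).const_mul (q.coeff p)
    refine (this.congr fun n => ?_).trans_eq ?_
    · rw [Finset.sum_comm, Finset.mul_sum]
      refine Finset.sum_congr rfl fun p _ => ?_
      rw [← Finset.mul_sum]
      ring
    · congr 1
      exact Finset.sum_congr rfl fun p _ => by ring
  rw [Metric.tendsto_atTop]
  intro ε hε
  obtain ⟨q, hq⟩ := exists_polynomial_near_of_continuousOn (-R) R h hh.continuousOn (ε / 3)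
    (by positivity)
  obtain ⟨N, hN⟩ := Metric.tendsto_atTop.mp (hpoly q) (ε / 3) (by positivity)
  refine ⟨max N 1, fun n hn => ?_⟩
  have hn0 : (0 : ℝ) < n := by exact_mod_cast (le_max_right N 1).trans hn
  have h1 := hN n ((le_max_left N 1).trans hn)
  have h2 : |(1 / (n : ℝ)) * ∑ i, h (μ n i) - (1 / (n : ℝ)) * ∑ i, q.eval (μ n i)| ≤ ε / 3 := by
    rw [← mul_sub, ← Finset.sum_sub_distrib, abs_mul, abs_of_pos (by positivity),
      one_div_mul_eq_div, div_le_iff₀ hn0]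
    refine (Finset.abs_sum_le_sum_abs _ _).trans ?_
    refine (Finset.sum_le_card_nsmul _ _ (ε / 3) fun i _ => ?_).trans_eq (by simp [mul_comm])
    rw [abs_sub_comm]
    exact (hq _ (abs_le.mp (hμ n i))).le
  have h3 : |(1 / (2 * Real.pi)) * (∫ ω in (0 : ℝ)..(2 * Real.pi), q.eval (F ω)) -
      (1 / (2 * Real.pi)) * ∫ ω in (0 : ℝ)..(2 * Real.pi), h (F ω)| ≤ ε / 3 := by
    have hpi : (0 : ℝ) < 2 * Real.pi := by positivity
    rw [← mul_sub, ← intervalIntegral.integral_sub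
      (Continuous.intervalIntegrable (by fun_prop) _ _)
      (Continuous.intervalIntegrable (by fun_prop) _ _), abs_mul, abs_of_pos (by positivity),
      one_div_mul_eq_div, div_le_iff₀ hpi]
    rw [← Real.norm_eq_abs]
    refine (intervalIntegral.norm_integral_le_of_norm_le_const (C := ε / 3)
      fun ω _ => ?_).trans_eq ?_
    · exact (hq _ (abs_le.mp (hFR ω))).le
    · rw [sub_zero, abs_of_pos hpi]
  rw [Real.dist_eq] at h1 ⊢
  rw [abs_lt] at h1 ⊢
  rw [abs_le] at h2 h3
  constructor <;> linarith

/-- The sequence of diagonals of a symmetric banded Toeplitz matrix of bandwidth `m`. -/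
def bandSeq (m : ℕ) (b : ℕ → ℝ) (k : ℤ) : ℝ := if k.natAbs ≤ m then b k.natAbs else 0

lemma summable_bandSeq (m : ℕ) (b : ℕ → ℝ) : Summable fun k => |bandSeq m b k| := by
  refine summable_of_hasFiniteSupport ((Finset.Icc (-m : ℤ) m).finite_toSet.subset fun k hk => ?_)
  by_contra h
  simp only [Finset.coe_Icc, Set.mem_Icc] at h
  simp only [bandSeq, Function.mem_support] at hk
  rw [if_neg (by omega)] at hk
  simp at hk

lemma toeplitzSymbol_bandSeq (m : ℕ) (b : ℕ → ℝ) (ω : ℝ) :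
    toeplitzSymbol (bandSeq m b) ω =
      ((b 0 + 2 * ∑ l ∈ Finset.Icc 1 m, b l * Real.cos (l * ω) : ℝ) : ℂ) := by
  have hs : Summable fun k : ℤ =>
      (bandSeq m b k : ℂ) * Complex.exp (-Complex.I * k * ω) :=
    Summable.of_norm ((summable_bandSeq m b).congr fun k => (norm_symbol_term _ k ω).symm)
  have hterm (l : ℕ) : (bandSeq m b (l + 1 : ℕ) : ℂ) *
        Complex.exp (-Complex.I * ((l + 1 : ℕ) : ℤ) * ω) +
      (bandSeq m b (-(l + 1 : ℕ)) : ℂ) * Complex.exp (-Complex.I * (-(l + 1 : ℕ) : ℤ) * ω) =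
      if l + 1 ≤ m then ((2 * (b (l + 1) * Real.cos ((l + 1 : ℕ) * ω)) : ℝ) : ℂ) else 0 := by
    simp only [bandSeq, Int.natAbs_neg, Int.natAbs_natCast]
    split_ifs
    · push_cast [Complex.cos]
      ring_nf
    · simp
  have h1 := hs.comp_injective (i := fun l : ℕ => ((l + 1 : ℕ) : ℤ)) fun l l' h => by
    simp only at h; omega
  have h2 := hs.comp_injective (i := fun l : ℕ => -((l + 1 : ℕ) : ℤ)) fun l l' h => by
    simp only at h; omega
  have hsplit := tsum_of_add_one_of_neg_add_one
    (f := fun k : ℤ => (bandSeq m b k : ℂ) * Complex.exp (-Complex.I * k * ω)) h1 h2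
  rw [toeplitzSymbol, hsplit, add_right_comm]
  have hadd := (h1.tsum_add h2).symm
  simp only [Function.comp_def, hterm] at hadd
  push_cast at hadd ⊢
  rw [hadd, tsum_eq_sum (s := Finset.range m) fun l hl => if_neg (by simpa using hl),
    ← Finset.Ico_add_one_right_eq_Icc, Finset.mul_sum,
    Finset.sum_Ico_eq_sum_range _ 1, Nat.add_sub_cancel]
  have h0 : (bandSeq m b 0 : ℂ) * Complex.exp (-Complex.I * 0 * ω) = b 0 := by simp [bandSeq]
  rw [h0, add_comm]
  congr 1
  refine Finset.sum_congr rfl fun l hl => ?_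
  rw [if_pos (Nat.succ_le_of_lt (Finset.mem_range.mp hl)), add_comm 1 l]
  push_cast
  rfl

/-- asymptotic eigenvalue distribution of products of a banded symmetric
Toeplitz matrix `Q̃ₙ` (with symbol `g_m(ω) = b₀ + 2 ∑_{l=1}^m b_l cos lω`) with the Toeplitz
covariance matrices `Σₙ = (r(i-j))` of an absolutely summable symmetric autocovariance with
spectral density `0 ≤ S ≤ M`: for every continuous `h : ℝ → ℝ`, with `μᵢ⁽ⁿ⁾` the eigenvalues
of `Q̃ₙ Σₙ`, `(1/n) ∑ᵢ h(μᵢ⁽ⁿ⁾) → (1/2π) ∫₀^{2π} h(g_m(ω) S(ω)) dω`. -/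
theorem banded_toeplitz_product_eigenvalue_distribution
    (r : ℤ → ℝ) (hsymm : ∀ k, r (-k) = r k) (hsum : Summable fun k => |r k|)
    (S : ℝ → ℝ)
    (hS : ∀ ω : ℝ, (S ω : ℂ) = ∑' k : ℤ, (r k : ℂ) * Complex.exp (-Complex.I * k * ω))
    (M : ℝ) (hbound : ∀ ω : ℝ, 0 ≤ S ω ∧ S ω ≤ M)
    (hpsd : ∀ n : ℕ, (Matrix.of fun i j : Fin n => r ((i.val : ℤ) - (j.val : ℤ))).PosSemidef)
    (m : ℕ) (b : ℕ → ℝ)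
    (Qb : (n : ℕ) → Matrix (Fin n) (Fin n) ℝ)
    (hQb : ∀ (n : ℕ) (i j : Fin n), Qb n i j
        = if ((i.val : ℤ) - (j.val : ℤ)).natAbs ≤ m then b (((i.val : ℤ) - (j.val : ℤ)).natAbs)
          else 0)
    (g : ℝ → ℝ)
    (hg : ∀ ω : ℝ, g ω = b 0 + 2 * ∑ l ∈ Finset.Icc 1 m, b l * Real.cos (l * ω))
    (μ : (n : ℕ) → Fin n → ℝ)
    (hμ : ∀ n : ℕ, (Qb n * Matrix.of fun i j : Fin n => r ((i.val : ℤ) - (j.val : ℤ))).charpoly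
        = ∏ i, (Polynomial.X - Polynomial.C (μ n i)))
    (h : ℝ → ℝ) (hh : Continuous h) :
    Tendsto (fun n : ℕ => (1 / (n : ℝ)) * ∑ i, h (μ n i)) atTop
      (𝓝 ((1 / (2 * Real.pi)) * ∫ ω in (0 : ℝ)..(2 * Real.pi), h (g ω * S ω))) := by
  have hg' (ω : ℝ) : toeplitzSymbol (bandSeq m b) ω = (g ω : ℂ) := by
    rw [hg, toeplitzSymbol_bandSeq]
  have hS' (ω : ℝ) : toeplitzSymbol r ω = (S ω : ℂ) := (hS ω).symm
  have hQ (n : ℕ) : Qb n = toeplitzMatrix (bandSeq m b) n := by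
    ext i j
    rw [hQb]
    rfl
  have hQherm (n : ℕ) : (Qb n).IsHermitian := by
    ext i j
    rw [Matrix.conjTranspose_apply, hQb, hQb, ← Int.natAbs_neg, neg_sub, star_trivial]
  have hb := summable_bandSeq m b
  refine tendsto_average_of_polynomial (R := (∑' k, |bandSeq m b k|) * ∑' k, |r k|)
    (fun n i => ?_) (F := fun ω => g ω * S ω) ?_ (fun ω => ?_) (fun p => ?_) hh
  · refine abs_le_of_charpoly_eq_prod (fun i => ?_) (hμ n) i
    refine (sum_abs_mul_row_le _ _ (toeplitzMatrix_row_sum_le hsum) i).trans ?_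
    rw [hQ]
    gcongr
    exact toeplitzMatrix_row_sum_le hb i
  · have hcont : Continuous fun ω => toeplitzSymbol (bandSeq m b) ω * toeplitzSymbol r ω :=
      (continuous_toeplitzSymbol hb).mul (continuous_toeplitzSymbol hsum)
    refine (Complex.continuous_re.comp hcont).congr fun ω => ?_
    simp [hg', hS']
  · have := mul_le_mul (norm_toeplitzSymbol_le hb ω) (norm_toeplitzSymbol_le hsum ω)
      (norm_nonneg _) (tsum_nonneg fun _ => abs_nonneg _)
    rwa [hg', hS', Complex.norm_real, Complex.norm_real, ← norm_mul] at this
  · have hpow := HasToeplitzSymbol.pow_mul hb hsum p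
    have hfun : (toeplitzSymbol (bandSeq m b) * toeplitzSymbol r) ^ p =
        fun ω => (((g ω * S ω) ^ p : ℝ) : ℂ) := by
      ext ω
      simp [hg', hS']
    rw [hfun] at hpow
    refine hpow.tendsto_trace.congr fun n => ?_
    rw [sum_pow_eq_trace_pow_mul (hQherm n) (hpsd n) (hμ n), hQ]
    rfl
end

section
/- (Szegő log-determinant limit) Let σ > 0, θ > 0, and let r : ℤ → ℝ satisfy r(−k) = r(k) and Σ_k |r(k)| < ∞, with spectral density f_s(ω) = Σ_{k∈ℤ} r(k)e^{−ikω} satisfying 0 ≤ f_s(ω) ≤ M for all ω, and suppose each Toeplitz matrix Σ_{s,n} = (r(i−j))_{1≤i,j≤n} is positive semidefinite. Then lim_{n→∞} (1/n)·log det(σ²I + θ²Σ_{s,n}) = (1/2π)∫₀^{2π} log(σ² + θ²f_s(ω)) dω. -/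
open Matrix Filter Topology

/-- The real Toeplitz matrix with entries `b (i - j)`. -/
def toeplitz (b : ℤ → ℝ) (n : ℕ) : Matrix (Fin n) (Fin n) ℝ :=
  Matrix.of fun i j : Fin n => b ((i.val : ℤ) - (j.val : ℤ))

/-- The symbol `∑ b k cos (k ω)` of an even sequence `b`. -/
noncomputable def cosSymbol (b : ℤ → ℝ) (ω : ℝ) : ℝ := ∑' k : ℤ, b k * Real.cos (k * ω)

/-- The squared modulus of the trigonometric polynomial `∑ v k e^{ikω}`. -/
noncomputable def energy {n : ℕ} (v : Fin n → ℝ) (ω : ℝ) : ℝ :=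
  (v ⬝ᵥ fun k => Real.cos (k.val * ω)) ^ 2 + (v ⬝ᵥ fun k => Real.sin (k.val * ω)) ^ 2

/-- The Fejér mean of the symbol of `b`. -/
noncomputable def fejerMean (b : ℤ → ℝ) (n : ℕ) (ω : ℝ) : ℝ :=
  (n : ℝ)⁻¹ * ∑ i : Fin n, ∑ j : Fin n,
    b ((i.val : ℤ) - j.val) * Real.cos (((i.val : ℤ) - j.val : ℤ) * ω)

lemma integral_cos_int_mul (k : ℤ) :
    ∫ ω in (0 : ℝ)..(2 * Real.pi), Real.cos (k * ω) = if k = 0 then 2 * Real.pi else 0 := by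
  split_ifs with hk
  · simp [hk]
  · have hk' : (k : ℝ) ≠ 0 := by exact_mod_cast hk
    rw [intervalIntegral.integral_comp_mul_left (fun x => Real.cos x) hk', integral_cos]
    have : Real.sin (k * (2 * Real.pi)) = 0 := by
      have := Real.sin_int_mul_pi (2 * k)
      push_cast at this
      rw [← this]
      ring_nf
    simp [this]

lemma integral_cos_mul_cos (k m : ℤ) :
    ∫ ω in (0 : ℝ)..(2 * Real.pi), Real.cos (k * ω) * Real.cos (m * ω) =
      (if k = m then Real.pi else 0) + (if k = -m then Real.pi else 0) := by
  have h : ∀ ω : ℝ, Real.cos (k * ω) * Real.cos (m * ω) =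
      (1 / 2) * Real.cos ((k - m : ℤ) * ω) + (1 / 2) * Real.cos ((k + m : ℤ) * ω) := by
    intro ω
    push_cast
    rw [sub_mul, add_mul, Real.cos_sub, Real.cos_add]
    ring
  simp_rw [h]
  rw [intervalIntegral.integral_add (Continuous.intervalIntegrable (by fun_prop) _ _)
    (Continuous.intervalIntegrable (by fun_prop) _ _), intervalIntegral.integral_const_mul,
    intervalIntegral.integral_const_mul, integral_cos_int_mul, integral_cos_int_mul]
  simp only [sub_eq_zero, ← eq_neg_iff_add_eq_zero, mul_ite, mul_zero]
  congr 2 <;> ring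

section Symbol

variable {b : ℤ → ℝ}

lemma norm_mul_cos_le (b : ℤ → ℝ) (k : ℤ) (x : ℝ) : ‖b k * Real.cos x‖ ≤ |b k| := by
  rw [norm_mul, Real.norm_eq_abs, Real.norm_eq_abs]
  exact mul_le_of_le_one_right (abs_nonneg _) (Real.abs_cos_le_one _)

lemma summable_mul_cos (hsum : Summable fun k => |b k|) (ω : ℝ) :
    Summable fun k : ℤ => b k * Real.cos (k * ω) :=
  Summable.of_norm_bounded hsum fun k => norm_mul_cos_le b k _

lemma continuous_cosSymbol (hsum : Summable fun k => |b k|) : Continuous (cosSymbol b) :=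
  continuous_tsum (fun k => by fun_prop) hsum fun k _ => norm_mul_cos_le b k _

lemma cosSymbol_le (hsum : Summable fun k => |b k|) (ω : ℝ) :
    cosSymbol b ω ≤ ∑' k, |b k| :=
  (summable_mul_cos hsum ω).tsum_le_tsum
    (fun k => (le_abs_self _).trans (norm_mul_cos_le b k _)) hsum

lemma integral_cosSymbol_mul_cos (hsymm : ∀ k, b (-k) = b k) (hsum : Summable fun k => |b k|)
    (m : ℤ) :
    ∫ ω in (0 : ℝ)..(2 * Real.pi), cosSymbol b ω * Real.cos (m * ω) = 2 * Real.pi * b m := by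
  have h : HasSum (fun k : ℤ => ∫ ω in (0 : ℝ)..(2 * Real.pi),
      b k * Real.cos (k * ω) * Real.cos (m * ω))
      (∫ ω in (0 : ℝ)..(2 * Real.pi), cosSymbol b ω * Real.cos (m * ω)) := by
    refine intervalIntegral.hasSum_integral_of_dominated_convergence (fun k _ => |b k|)
      (fun k => Continuous.aestronglyMeasurable (by fun_prop)) (fun k => .of_forall fun ω _ => ?_)
      (.of_forall fun _ _ => hsum) (by simp) (.of_forall fun ω _ => ?_)
    · rw [norm_mul]
      exact (mul_le_of_le_one_right (norm_nonneg _) (Real.abs_cos_le_one _)).trans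
        (norm_mul_cos_le b k _)
    · exact (summable_mul_cos hsum ω).hasSum.mul_right _
  simp_rw [mul_assoc, intervalIntegral.integral_const_mul, integral_cos_mul_cos, mul_add] at h
  have h' := (hasSum_ite_eq m (b m * Real.pi)).add (hasSum_ite_eq (-m) (b (-m) * Real.pi))
  simp_rw [mul_ite, mul_zero] at h
  rw [hsymm] at h'
  rw [h.unique (h'.congr_fun fun k => ?_)]
  · ring
  · split_ifs <;> simp_all

end Symbol

section Energy

variable {n : ℕ}

lemma energy_nonneg (v : Fin n → ℝ) (ω : ℝ) : 0 ≤ energy v ω := by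
  unfold energy
  positivity

lemma continuous_energy (v : Fin n → ℝ) : Continuous (energy v) := by
  unfold energy dotProduct
  fun_prop

lemma energy_eq_sum (v : Fin n → ℝ) (ω : ℝ) :
    energy v ω = ∑ i, ∑ j, v i * v j * Real.cos (((i.val : ℤ) - j.val : ℤ) * ω) := by
  simp only [energy, dotProduct, sq, Finset.sum_mul_sum, ← Finset.sum_add_distrib]
  refine Finset.sum_congr rfl fun i _ => Finset.sum_congr rfl fun j _ => ?_
  push_cast
  rw [sub_mul, Real.cos_sub]
  ring

lemma integral_mul_energy {g : ℝ → ℝ} (hg : Continuous g)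
    (hgb : ∀ m : ℤ, ∫ ω in (0 : ℝ)..(2 * Real.pi), g ω * Real.cos (m * ω) = 2 * Real.pi * b m)
    (v : Fin n → ℝ) :
    ∫ ω in (0 : ℝ)..(2 * Real.pi), g ω * energy v ω =
      2 * Real.pi * (v ⬝ᵥ toeplitz b n *ᵥ v) := by
  have h : ∀ ω, g ω * energy v ω = ∑ i, ∑ j, v i * v j *
      (g ω * Real.cos (((i.val : ℤ) - j.val : ℤ) * ω)) := by
    intro ω
    simp only [energy_eq_sum, Finset.mul_sum]
    refine Finset.sum_congr rfl fun i _ => Finset.sum_congr rfl fun j _ => ?_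
    ring
  simp_rw [h]
  rw [intervalIntegral.integral_finsetSum
    fun i _ => Continuous.intervalIntegrable (by fun_prop) _ _]
  simp only [dotProduct, mulVec, Finset.mul_sum, toeplitz, of_apply]
  refine Finset.sum_congr rfl fun i _ => ?_
  rw [intervalIntegral.integral_finsetSum
    fun i _ => Continuous.intervalIntegrable (by fun_prop) _ _]
  refine Finset.sum_congr rfl fun j _ => ?_
  rw [intervalIntegral.integral_const_mul, hgb]
  ring

lemma integral_energy (v : Fin n → ℝ) :
    ∫ ω in (0 : ℝ)..(2 * Real.pi), energy v ω = 2 * Real.pi * (v ⬝ᵥ v) := by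
  have h := integral_mul_energy (b := Pi.single 0 1) (g := fun _ => 1) continuous_const
    (fun m => by simp [integral_cos_int_mul, Pi.single_apply]) v
  have h1 : toeplitz (Pi.single 0 1) n = 1 := by
    ext i j
    simp [toeplitz, Pi.single_apply, Matrix.one_apply, sub_eq_zero, Fin.ext_iff]
  simpa [h1] using h

lemma fejerMean_mul (b : ℤ → ℝ) (hn : n ≠ 0) (ω : ℝ) :
    n * fejerMean b n ω =
      (fun k : Fin n => Real.cos (k.val * ω)) ⬝ᵥ
          toeplitz b n *ᵥ (fun k => Real.cos (k.val * ω)) +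
        (fun k : Fin n => Real.sin (k.val * ω)) ⬝ᵥ
          toeplitz b n *ᵥ (fun k => Real.sin (k.val * ω)) := by
  rw [fejerMean, mul_inv_cancel_left₀ (by exact_mod_cast hn)]
  simp only [dotProduct, mulVec, Finset.mul_sum, toeplitz, of_apply, ← Finset.sum_add_distrib]
  refine Finset.sum_congr rfl fun i _ => Finset.sum_congr rfl fun j _ => ?_
  push_cast
  rw [sub_mul, Real.cos_sub]
  ring

lemma continuous_fejerMean (b : ℤ → ℝ) (n : ℕ) : Continuous (fejerMean b n) := by
  unfold fejerMean
  fun_prop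

end Energy

lemma tendsto_fejerMean {b : ℤ → ℝ} (hsum : Summable fun k => |b k|) (ω : ℝ) :
    Tendsto (fun n => fejerMean b n ω) atTop (𝓝 (cosSymbol b ω)) := by
  set u : ℤ → ℝ := fun k => b k * Real.cos (k * ω) with hu
  have hs : Summable u := summable_mul_cos hsum ω
  have hpos : Summable fun n : ℕ => u n := hs.comp_injective Nat.cast_injective
  have hneg : Summable fun n : ℕ => u (-(n + 1)) :=
    hs.comp_injective (i := fun n : ℕ => (-(n + 1) : ℤ)) fun a b h => by simpa using h
  have hlim : Tendsto (fun n : ℕ => ∑ i ∈ Finset.range (n + 1), u i +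
      ∑ i ∈ Finset.range n, u (-(i + 1))) atTop (𝓝 (cosSymbol b ω)) := by
    rw [show cosSymbol b ω = ∑' k, u k from rfl, tsum_of_nat_of_neg_add_one hpos hneg]
    exact ((tendsto_add_atTop_iff_nat 1).2 hpos.hasSum.tendsto_sum_nat).add
      hneg.hasSum.tendsto_sum_nat
  refine hlim.cesaro.congr fun n => ?_
  rw [fejerMean]
  congr 1
  have hrange : ∀ n : ℕ, ∑ k ∈ Finset.range n, (∑ i ∈ Finset.range (k + 1), u i +
      ∑ i ∈ Finset.range k, u (-(i + 1))) =
      ∑ i ∈ Finset.range n, ∑ j ∈ Finset.range n, u ((i : ℤ) - j) := by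
    intro n
    induction n with
    | zero => simp
    | succ n ih =>
      have hleft : ∑ i ∈ Finset.range n, u (-(i + 1)) = ∑ i ∈ Finset.range n, u ((i : ℤ) - n) := by
        rw [← Finset.sum_range_reflect (fun i : ℕ => u ((i : ℤ) - n))]
        refine Finset.sum_congr rfl fun i hi => congrArg u ?_
        have := Finset.mem_range.1 hi
        omega
      have hright : ∑ j ∈ Finset.range (n + 1), u j =
          ∑ j ∈ Finset.range (n + 1), u ((n : ℤ) - j) := by
        rw [← Finset.sum_range_reflect (fun j : ℕ => u j)]
        refine Finset.sum_congr rfl fun j hj => congrArg u ?_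
        have := Finset.mem_range.1 hj
        omega
      rw [Finset.sum_range_succ, ih, hleft, hright,
        Finset.sum_range_succ (fun i : ℕ => ∑ j ∈ Finset.range (n + 1), u ((i : ℤ) - j)),
        Finset.sum_congr rfl fun (i : ℕ) _ => Finset.sum_range_succ (fun j : ℕ => u ((i : ℤ) - j)) n,
        Finset.sum_add_distrib]
      ring
  rw [hrange, Finset.sum_range]
  simp_rw [Finset.sum_range, hu]

lemma exists_orthonormal_eigenvectors {n : ℕ} {A : Matrix (Fin n) (Fin n) ℝ}
    (hA : A.IsHermitian) :
    ∃ (v : Fin n → Fin n → ℝ) (μ : Fin n → ℝ), A.det = ∏ j, μ j ∧ (∀ j, v j ⬝ᵥ v j = 1) ∧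
      (∀ j, A *ᵥ v j = μ j • v j) ∧
      ∀ x y, ∑ j, (v j ⬝ᵥ x) * (v j ⬝ᵥ y) = x ⬝ᵥ y := by
  refine ⟨fun j => hA.eigenvectorBasis j, hA.eigenvalues, by simpa using hA.det_eq_prod_eigenvalues,
    fun j => ?_, hA.mulVec_eigenvectorBasis, fun x y => ?_⟩
  · have := hA.eigenvectorBasis.inner_eq_one j
    rwa [EuclideanSpace.inner_eq_star_dotProduct, star_trivial] at this
  · have := hA.eigenvectorBasis.sum_inner_mul_inner (WithLp.toLp 2 x) (WithLp.toLp 2 y)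
    simp only [EuclideanSpace.inner_eq_star_dotProduct, star_trivial] at this
    rw [dotProduct_comm x, ← this]
    exact Finset.sum_congr rfl fun j _ => by rw [dotProduct_comm y]

lemma toeplitz_isHermitian {b : ℤ → ℝ} (hsymm : ∀ k, b (-k) = b k) (n : ℕ) :
    (toeplitz b n).IsHermitian := by
  ext i j
  simp [toeplitz, ← hsymm ((i : ℤ) - j)]

lemma log_le_log_add_div_sub_one {x y : ℝ} (hx : 0 < x) (hy : 0 < y) :
    Real.log x ≤ Real.log y + x / y - 1 := by
  have := Real.log_le_sub_one_of_pos (div_pos hx hy)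
  rw [Real.log_div hx.ne' hy.ne'] at this
  linarith

/-- Berezin–Lieb type bounds: the log-determinant of a Toeplitz matrix lies between the integrals
of the logarithms of its symbol and of the Fejér mean of its symbol. -/
lemma log_det_toeplitz_bounds {b : ℤ → ℝ} (hsymm : ∀ k, b (-k) = b k)
    (hsum : Summable fun k => |b k|) {c : ℝ} (hc : 0 < c) (hbound : ∀ ω, c ≤ cosSymbol b ω)
    {n : ℕ} (hn : n ≠ 0) :
    (∀ ω, c ≤ fejerMean b n ω ∧ fejerMean b n ω ≤ ∑' k, |b k|) ∧
    ∫ ω in (0 : ℝ)..(2 * Real.pi), Real.log (cosSymbol b ω) ≤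
      2 * Real.pi * (1 / (n : ℝ) * Real.log (toeplitz b n).det) ∧
    2 * Real.pi * (1 / (n : ℝ) * Real.log (toeplitz b n).det) ≤
      ∫ ω in (0 : ℝ)..(2 * Real.pi), Real.log (fejerMean b n ω) := by
  obtain ⟨v, μ, hdet, hv1, hμ, hv⟩ := exists_orthonormal_eigenvectors (toeplitz_isHermitian hsymm n)
  have hn0 : (0 : ℝ) < n := by exact_mod_cast Nat.pos_of_ne_zero hn
  have h2pi := Real.two_pi_pos
  have hcont := continuous_cosSymbol hsum
  have hE : ∀ j, Continuous (energy (v j)) := fun j => continuous_energy _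
  have hintE : ∀ j, ∫ ω in (0 : ℝ)..(2 * Real.pi), energy (v j) ω = 2 * Real.pi := fun j => by
    rw [integral_energy, hv1, mul_one]
  have hintaE : ∀ j, ∫ ω in (0 : ℝ)..(2 * Real.pi), cosSymbol b ω * energy (v j) ω =
      2 * Real.pi * μ j := fun j => by
    rw [integral_mul_energy hcont (integral_cosSymbol_mul_cos hsymm hsum), hμ,
      dotProduct_smul, hv1, smul_eq_mul, mul_one]
  have hμc : ∀ j, c ≤ μ j := fun j => by
    refine le_of_mul_le_mul_left ?_ h2pi
    calc 2 * Real.pi * c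
        = ∫ ω in (0 : ℝ)..(2 * Real.pi), c * energy (v j) ω := by
          rw [intervalIntegral.integral_const_mul, hintE, mul_comm]
      _ ≤ ∫ ω in (0 : ℝ)..(2 * Real.pi), cosSymbol b ω * energy (v j) ω :=
          intervalIntegral.integral_mono_on h2pi.le
            (Continuous.intervalIntegrable (by fun_prop) _ _)
            (Continuous.intervalIntegrable (by fun_prop) _ _)
            fun ω _ => mul_le_mul_of_nonneg_right (hbound ω) (energy_nonneg _ _)
      _ = 2 * Real.pi * μ j := hintaE j
  have hμM : ∀ j, μ j ≤ ∑' k, |b k| := fun j => by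
    refine le_of_mul_le_mul_left ?_ h2pi
    calc 2 * Real.pi * μ j
        = ∫ ω in (0 : ℝ)..(2 * Real.pi), cosSymbol b ω * energy (v j) ω := (hintaE j).symm
      _ ≤ ∫ ω in (0 : ℝ)..(2 * Real.pi), (∑' k, |b k|) * energy (v j) ω :=
          intervalIntegral.integral_mono_on h2pi.le
            (Continuous.intervalIntegrable (by fun_prop) _ _)
            (Continuous.intervalIntegrable (by fun_prop) _ _)
            fun ω _ => mul_le_mul_of_nonneg_right (cosSymbol_le hsum ω) (energy_nonneg _ _)
      _ = 2 * Real.pi * ∑' k, |b k| := by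
          rw [intervalIntegral.integral_const_mul, hintE, mul_comm]
  have hμ0 : ∀ j, 0 < μ j := fun j => hc.trans_le (hμc j)
  have hsumE : ∀ ω, ∑ j, energy (v j) ω = n := fun ω => by
    simp only [energy, Finset.sum_add_distrib, sq, hv]
    simp only [dotProduct, ← Finset.sum_add_distrib, ← sq, Real.cos_sq_add_sin_sq]
    simp
  have hquad : ∀ x, ∑ j, μ j * (v j ⬝ᵥ x) ^ 2 = x ⬝ᵥ toeplitz b n *ᵥ x := fun x => by
    rw [← hv]
    refine Finset.sum_congr rfl fun j _ => ?_
    rw [dotProduct_mulVec, ← mulVec_transpose, ← conjTranspose_eq_transpose_of_trivial,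
      (toeplitz_isHermitian hsymm n).eq, hμ, smul_dotProduct, smul_eq_mul]
    ring
  have hsumμE : ∀ ω, ∑ j, μ j * energy (v j) ω = n * fejerMean b n ω := fun ω => by
    rw [fejerMean_mul b hn, ← hquad, ← hquad, ← Finset.sum_add_distrib]
    exact Finset.sum_congr rfl fun j _ => mul_add _ _ _
  have hF : ∀ ω, c ≤ fejerMean b n ω ∧ fejerMean b n ω ≤ ∑' k, |b k| := fun ω => by
    constructor <;> refine le_of_mul_le_mul_left ?_ hn0 <;>
      rw [← hsumμE, ← hsumE ω, Finset.sum_mul] <;> refine Finset.sum_le_sum fun j _ => ?_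
    · rw [mul_comm]
      exact mul_le_mul_of_nonneg_right (hμc j) (energy_nonneg _ _)
    · rw [mul_comm]
      exact mul_le_mul_of_nonneg_left (hμM j) (energy_nonneg _ _)
  have hlogdet : 2 * Real.pi * Real.log (toeplitz b n).det =
      ∫ ω in (0 : ℝ)..(2 * Real.pi), ∑ j, Real.log (μ j) * energy (v j) ω := by
    rw [intervalIntegral.integral_finsetSum
      fun i _ => Continuous.intervalIntegrable (by fun_prop) _ _]
    simp_rw [intervalIntegral.integral_const_mul, hintE]
    rw [hdet, Real.log_prod fun j _ => (hμ0 j).ne', Finset.mul_sum]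
    exact Finset.sum_congr rfl fun j _ => mul_comm _ _
  have hrw : 2 * Real.pi * (1 / (n : ℝ) * Real.log (toeplitz b n).det) =
      (n : ℝ)⁻¹ * (2 * Real.pi * Real.log (toeplitz b n).det) := by ring
  have hloga : Continuous fun ω => Real.log (cosSymbol b ω) :=
    hcont.log fun ω => (hc.trans_le (hbound ω)).ne'
  have hlogF : Continuous fun ω => Real.log (fejerMean b n ω) :=
    (continuous_fejerMean b n).log fun ω => (hc.trans_le (hF ω).1).ne'
  refine ⟨hF, ?_, ?_⟩
  · rw [hrw, le_inv_mul_iff₀ hn0, ← intervalIntegral.integral_const_mul]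
    have hdiv : ∫ ω in (0 : ℝ)..(2 * Real.pi),
        ∑ j, ((μ j)⁻¹ * (cosSymbol b ω * energy (v j) ω) - energy (v j) ω) = 0 := by
      rw [intervalIntegral.integral_finsetSum
        fun i _ => Continuous.intervalIntegrable (by fun_prop) _ _]
      refine Finset.sum_eq_zero fun j _ => ?_
      rw [intervalIntegral.integral_sub (Continuous.intervalIntegrable (by fun_prop) _ _)
        (Continuous.intervalIntegrable (by fun_prop) _ _), intervalIntegral.integral_const_mul,
        hintaE, hintE]
      field_simp [(hμ0 j).ne']
      ring
    suffices h : ∫ ω in (0 : ℝ)..(2 * Real.pi), n * Real.log (cosSymbol b ω) ≤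
        ∫ ω in (0 : ℝ)..(2 * Real.pi), (∑ j, Real.log (μ j) * energy (v j) ω +
          ∑ j, ((μ j)⁻¹ * (cosSymbol b ω * energy (v j) ω) - energy (v j) ω)) by
      rwa [intervalIntegral.integral_add (Continuous.intervalIntegrable (by fun_prop) _ _)
        (Continuous.intervalIntegrable (by fun_prop) _ _), hdiv, add_zero, ← hlogdet] at h
    refine intervalIntegral.integral_mono_on h2pi.le
      (Continuous.intervalIntegrable (by fun_prop) _ _)
      (Continuous.intervalIntegrable (by fun_prop) _ _) fun ω _ => ?_
    rw [← hsumE ω, Finset.sum_mul, ← Finset.sum_add_distrib]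
    refine Finset.sum_le_sum fun j _ => ?_
    have := mul_le_mul_of_nonneg_left
      (log_le_log_add_div_sub_one (hc.trans_le (hbound ω)) (hμ0 j)) (energy_nonneg (v j) ω)
    refine this.trans_eq ?_
    ring
  · rw [hrw, inv_mul_le_iff₀ hn0, ← intervalIntegral.integral_const_mul, hlogdet]
    refine intervalIntegral.integral_mono_on h2pi.le
      (Continuous.intervalIntegrable (by fun_prop) _ _)
      (Continuous.intervalIntegrable (by fun_prop) _ _) fun ω _ => ?_
    have hF0 : 0 < fejerMean b n ω := hc.trans_le (hF ω).1
    calc ∑ j, Real.log (μ j) * energy (v j) ω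
        ≤ ∑ j, (Real.log (fejerMean b n ω) * energy (v j) ω +
            (fejerMean b n ω)⁻¹ * (μ j * energy (v j) ω) - energy (v j) ω) := by
          refine Finset.sum_le_sum fun j _ => ?_
          have := mul_le_mul_of_nonneg_right
            (log_le_log_add_div_sub_one (hμ0 j) hF0) (energy_nonneg (v j) ω)
          refine this.trans_eq ?_
          ring
      _ = n * Real.log (fejerMean b n ω) := by
          rw [Finset.sum_sub_distrib, Finset.sum_add_distrib, ← Finset.mul_sum, ← Finset.mul_sum,
            hsumE, hsumμE]
          field_simp
          ring

/-- Szegő's limit theorem for even absolutely summable sequences with positive symbol. -/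
theorem tendsto_log_det_toeplitz {b : ℤ → ℝ} (hsymm : ∀ k, b (-k) = b k)
    (hsum : Summable fun k => |b k|) {c : ℝ} (hc : 0 < c) (hbound : ∀ ω, c ≤ cosSymbol b ω) :
    Tendsto (fun n : ℕ => 1 / (n : ℝ) * Real.log (toeplitz b n).det) atTop
      (𝓝 (1 / (2 * Real.pi) *
        ∫ ω in (0 : ℝ)..(2 * Real.pi), Real.log (cosSymbol b ω))) := by
  have h2pi := Real.two_pi_pos
  have hB {n : ℕ} (hn : n ≠ 0) := log_det_toeplitz_bounds hsymm hsum hc hbound hn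
  have hlim : Tendsto (fun n => ∫ ω in (0 : ℝ)..(2 * Real.pi), Real.log (fejerMean b n ω)) atTop
      (𝓝 (∫ ω in (0 : ℝ)..(2 * Real.pi), Real.log (cosSymbol b ω))) := by
    refine intervalIntegral.tendsto_integral_filter_of_dominated_convergence
      (fun _ => max |Real.log c| |Real.log (∑' k, |b k|)|) ?_ ?_ (by simp) ?_
    · filter_upwards [eventually_ne_atTop 0] with n hn
      exact ((continuous_fejerMean b n).log
        fun ω => (hc.trans_le ((hB hn).1 ω).1).ne').aestronglyMeasurable
    · filter_upwards [eventually_ne_atTop 0] with n hn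
      refine .of_forall fun ω _ => ?_
      have h := (hB hn).1 ω
      exact abs_le_max_abs_abs (Real.log_le_log hc h.1)
        (Real.log_le_log (hc.trans_le h.1) h.2)
    · exact .of_forall fun ω _ => (tendsto_fejerMean hsum ω).log (hc.trans_le (hbound ω)).ne'
  have hmain : Tendsto (fun n : ℕ => 2 * Real.pi * (1 / (n : ℝ) * Real.log (toeplitz b n).det))
      atTop (𝓝 (∫ ω in (0 : ℝ)..(2 * Real.pi), Real.log (cosSymbol b ω))) := by
    refine tendsto_of_tendsto_of_tendsto_of_le_of_le' tendsto_const_nhds hlim ?_ ?_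
    · filter_upwards [eventually_ne_atTop 0] with n hn using (hB hn).2.1
    · filter_upwards [eventually_ne_atTop 0] with n hn using (hB hn).2.2
  refine (hmain.const_mul (1 / (2 * Real.pi))).congr fun n => ?_
  field_simp

/-- Szegő log-determinant limit: let `σ, θ > 0` and let `r : ℤ → ℝ` be a
symmetric absolutely summable autocovariance with spectral density
`f_s(ω) = ∑_k r(k) e^{-ikω}` satisfying `0 ≤ f_s ≤ M`, whose Toeplitz matrices
`Σ_{s,n} = (r(i-j))` are positive semidefinite.  Then
`(1/n) log det (σ² I + θ² Σ_{s,n}) → (1/2π) ∫₀^{2π} log (σ² + θ² f_s(ω)) dω`. -/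
theorem szego_log_det_limit
    (σ θ : ℝ) (hσ : 0 < σ) (hθ : 0 < θ)
    (r : ℤ → ℝ) (hsymm : ∀ k, r (-k) = r k) (hsum : Summable fun k => |r k|)
    (f : ℝ → ℝ)
    (hf : ∀ ω : ℝ, (f ω : ℂ) = ∑' k : ℤ, (r k : ℂ) * Complex.exp (-Complex.I * k * ω))
    (M : ℝ) (hbound : ∀ ω : ℝ, 0 ≤ f ω ∧ f ω ≤ M)
    (hpsd : ∀ n : ℕ, (Matrix.of fun i j : Fin n => r ((i.val : ℤ) - (j.val : ℤ))).PosSemidef) :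
    Tendsto (fun n : ℕ => (1 / (n : ℝ)) * Real.log
        (σ ^ 2 • (1 : Matrix (Fin n) (Fin n) ℝ)
          + θ ^ 2 • Matrix.of fun i j : Fin n => r ((i.val : ℤ) - (j.val : ℤ))).det) atTop
      (𝓝 ((1 / (2 * Real.pi)) * ∫ ω in (0 : ℝ)..(2 * Real.pi),
          Real.log (σ ^ 2 + θ ^ 2 * f ω))) := by
  have hcos : ∀ ω, HasSum (fun k : ℤ => r k * Real.cos (k * ω)) (f ω) := by
    intro ω
    have hnorm : Summable fun k : ℤ => (r k : ℂ) * Complex.exp (-Complex.I * k * ω) := by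
      refine Summable.of_norm_bounded hsum fun k => ?_
      rw [norm_mul, show -Complex.I * k * ω = ((-(k * ω) : ℝ) : ℂ) * Complex.I by push_cast; ring,
        Complex.norm_exp_ofReal_mul_I, mul_one, Complex.norm_real, Real.norm_eq_abs]
    have h := Complex.hasSum_re (hf ω ▸ hnorm.hasSum)
    rw [Complex.ofReal_re] at h
    refine h.congr_fun fun k => ?_
    rw [show -Complex.I * k * ω = ((-(k * ω) : ℝ) : ℂ) * Complex.I by push_cast; ring,
      Complex.re_ofReal_mul, Complex.exp_ofReal_mul_I_re, Real.cos_neg]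
  set b : ℤ → ℝ := fun k => (if k = 0 then σ ^ 2 else 0) + θ ^ 2 * r k with hb
  have hsymb : ∀ ω, cosSymbol b ω = σ ^ 2 + θ ^ 2 * f ω := by
    intro ω
    refine (((hasSum_ite_eq (0 : ℤ) (σ ^ 2)).add ((hcos ω).mul_left (θ ^ 2))).congr_fun
      fun k => ?_).tsum_eq
    by_cases hk : k = 0 <;> simp [hb, hk, mul_assoc]
  have hbsum : Summable fun k => |b k| := by
    refine Summable.of_nonneg_of_le (fun _ => abs_nonneg _) (fun k => ?_)
      ((hasSum_ite_eq (0 : ℤ) (σ ^ 2)).summable.add (hsum.mul_left (θ ^ 2)))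
    refine (abs_add_le _ _).trans (add_le_add (le_of_eq ?_) (le_of_eq ?_))
    · split_ifs <;> simp
    · rw [abs_mul, abs_of_nonneg (sq_nonneg θ)]
  have hT : ∀ n, toeplitz b n = σ ^ 2 • (1 : Matrix (Fin n) (Fin n) ℝ)
      + θ ^ 2 • Matrix.of fun i j : Fin n => r ((i.val : ℤ) - (j.val : ℤ)) := by
    intro n
    ext i j
    simp [toeplitz, hb, Matrix.one_apply, sub_eq_zero, Fin.ext_iff]
  have := tendsto_log_det_toeplitz (b := b) (fun k => by simp [hb, hsymm]) hbsum
    (pow_pos hσ 2) fun ω => by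
      rw [hsymb]
      nlinarith [mul_nonneg (sq_nonneg θ) (hbound ω).1]
  simpa only [hsymb, hT] using this
end
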